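/- Let p and p' be odd primes, K a finite field extension of ℚ_p, and K' a finite field extension of ℚ_{p'}. Then there exists a bijection ι from the set of isometry classes of anisotropic quadratic forms over K (of all degrees, including degree 0) to the set of isometry classes of anisotropic quadratic forms over K', such that ι preserves degree, and such that for all anisotropic quadratic forms u, v over K and every anisotropic quadratic form w over K that is Witt equivalent to u ⊥ (−v), there is an anisotropic quadratic form over K' of degree equal to the degree of w that is Witt equivalent to ι(u) ⊥ (−ι(v)). -/

import Mathlib

/-- A quadratic form of degree `m` over `K`: a quadratic form on `Fin m → K`. -/
abbrev QF (K : Type) [Field K] (m : ℕ) : Type := QuadraticForm K (Fin m → K)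

/-- Two quadratic forms are isometric if there is a linear equivalence of the underlying
spaces carrying one to the other. -/
def QIsom {K : Type} [Field K] {M M' : Type} [AddCommGroup M] [Module K M]
    [AddCommGroup M'] [Module K M'] (Q : QuadraticForm K M) (Q' : QuadraticForm K M') : Prop :=
  ∃ φ : M ≃ₗ[K] M', ∀ x, Q' (φ x) = Q x

/-- The hyperbolic plane `(x, y) ↦ x * y` on `K²`. -/
noncomputable def HypForm (K : Type) [Field K] : QuadraticForm K (K × K) :=
  QuadraticMap.linMulLin (LinearMap.fst K K K) (LinearMap.snd K K K)

/-- Orthogonal sum of `m` copies of the hyperbolic plane. -/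
noncomputable def HypSum (K : Type) [Field K] (m : ℕ) : QuadraticForm K (Fin m → K × K) :=
  QuadraticMap.pi (fun _ : Fin m => HypForm K)

/-- Witt equivalence of quadratic forms. -/
def WittEquiv {K : Type} [Field K] {M M' : Type} [AddCommGroup M] [Module K M]
    [AddCommGroup M'] [Module K M'] (Q : QuadraticForm K M) (Q' : QuadraticForm K M') : Prop :=
  ∃ a b : ℕ, QIsom (Q.prod (HypSum K a)) (Q'.prod (HypSum K b))

/-- A quadratic form is nondegenerate if its polar bilinear form is nondegenerate. -/
def QNondeg {K : Type} [Field K] {M : Type} [AddCommGroup M] [Module K M]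
    (Q : QuadraticForm K M) : Prop :=
  ∀ v, (∀ w, QuadraticMap.polar (⇑Q) v w = 0) → v = 0

/-- The diagonal quadratic form `⟨a₁, …, a_m⟩`. -/
noncomputable def diagQF {K : Type} [Field K] {m : ℕ} (r : Fin m → Kˣ) : QF K m :=
  QuadraticMap.weightedSumSquares K (fun i => (r i : K))

/-- The Lie algebra `so(Q)`. -/
def soSet {K : Type} [Field K] {M : Type} [AddCommGroup M] [Module K M]
    (Q : QuadraticForm K M) : Set (Module.End K M) :=
  {X | ∀ v w, QuadraticMap.polar (⇑Q) (X v) w + QuadraticMap.polar (⇑Q) v (X w) = 0}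

/-- Membership in the orthogonal group `O(Q)` (as invertible linear maps preserving `Q`). -/
def InO {K : Type} [Field K] {M : Type} [AddCommGroup M] [Module K M]
    (Q : QuadraticForm K M) (g : M ≃ₗ[K] M) : Prop :=
  ∀ v, Q (g v) = Q v

/-- Membership in the special orthogonal group `SO(Q)`. -/
def InSO {K : Type} [Field K] {M : Type} [AddCommGroup M] [Module K M]
    (Q : QuadraticForm K M) (g : M ≃ₗ[K] M) : Prop :=
  InO Q g ∧ LinearMap.det (g : M →ₗ[K] M) = 1

/-- A nilpotent endomorphism has Jordan type `λ` when `dim ker (X^i) = Σ_j min(i, λ_j)`. -/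
def HasJordanType {K : Type} [Field K] {M : Type} [AddCommGroup M] [Module K M]
    {n : ℕ} (X : Module.End K M) (lam : Nat.Partition n) : Prop :=
  ∀ i : ℕ, Module.finrank K (LinearMap.ker (X ^ i)) = (lam.parts.map (fun part => min i part)).sum

/-- `Λ(n)`: partitions of `n` in which every even part has even multiplicity. -/
def LambdaSet (n : ℕ) : Set (Nat.Partition n) :=
  {lam | ∀ j : ℕ, Even j → Even (lam.parts.count j)}


/-- An anisotropic quadratic form over `F` of some degree. -/
def AniData (F : Type) [Field F] : Type :=
  Σ d : ℕ, {Q : QuadraticForm F (Fin d → F) // QuadraticMap.Anisotropic Q}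

/-- The isometry relation on anisotropic forms (quotienting gives isometry classes). -/
def AniRel (F : Type) [Field F] (x y : AniData F) : Prop := QIsom x.2.1 y.2.1

open IsLocalRing

/-- The arithmetic input. -/
def GoodField (K : Type) [Field K] (e π s t : K) : Prop :=
  (2 : K) ≠ 0 ∧
  (∀ x : K, x ≠ 0 → ∃ r : K, r ≠ 0 ∧
    (x = r ^ 2 ∨ x = e * r ^ 2 ∨ x = π * r ^ 2 ∨ x = π * (e * r ^ 2))) ∧
  s ^ 2 - e * t ^ 2 = -1 ∧
  ∀ x y z w : K, x ^ 2 - e * y ^ 2 + π * (z ^ 2 - e * w ^ 2) = 0 → x = 0 ∧ y = 0 ∧ z = 0 ∧ w = 0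

theorem sq_lift {R : Type*} [CommRing R] [IsLocalRing R] [HenselianRing R (maximalIdeal R)]
    (h2 : IsUnit (2 : R)) (u : R) (hu : IsUnit u) (h : IsSquare (residue R u)) :
    ∃ r : R, u = r ^ 2 := by
  obtain ⟨a, ha⟩ := h
  obtain ⟨a, rfl⟩ := residue_surjective a
  have hau : IsUnit a := by
    have : IsUnit (residue R u) := hu.map _
    rw [ha] at this
    have h3 : IsUnit (residue R a) := isUnit_of_mul_isUnit_left this
    exact (isUnit_map_iff (residue R) a).1 h3
  obtain ⟨r, hr, -⟩ := HenselianRing.is_henselian (I := maximalIdeal R)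
    (Polynomial.X ^ 2 - Polynomial.C u) (Polynomial.monic_X_pow_sub_C u two_ne_zero) a
    (by
      rw [← residue_eq_zero_iff]
      simp [ha, pow_two])
    (by
      simp only [Polynomial.derivative_sub, Polynomial.derivative_X_pow, Polynomial.derivative_C,
        sub_zero]
      apply IsUnit.map
      simpa using h2.mul hau)
  refine ⟨r, ?_⟩
  have : r ^ 2 - u = 0 := by simpa [Polynomial.IsRoot] using hr
  linear_combination -this

theorem good_of_dvr (R K : Type) [CommRing R] [IsDomain R] [IsDiscreteValuationRing R]
    [HenselianRing R (maximalIdeal R)] [Field K] [Algebra R K] [IsFractionRing R K]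
    [Finite (ResidueField R)] (h2 : IsUnit (2 : R)) : ∃ e π s t : K, GoodField K e π s t := by
  classical
  have := Fintype.ofFinite (ResidueField R)
  have inj : Function.Injective (algebraMap R K) := IsFractionRing.injective R K
  have hk2 : (2 : ResidueField R) ≠ 0 := by
    have := (h2.map (residue R)).ne_zero
    rwa [map_ofNat] at this
  have hchar : ringChar (ResidueField R) ≠ 2 := by
    intro h
    apply hk2
    have := ringChar.Nat.cast_ringChar (R := ResidueField R)
    rw [h] at this
    simpa using this
  obtain ⟨e', he'⟩ := FiniteField.exists_nonsquare hchar
  obtain ⟨e, rfl⟩ := residue_surjective e'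
  have he0 : residue R e ≠ 0 := by
    rintro h; rw [h] at he'; exact he' (by simp)
  have heu : IsUnit e := by
    rw [← isUnit_map_iff (residue R)]; exact he0.isUnit
  obtain ⟨π, hπ⟩ := IsDiscreteValuationRing.exists_irreducible R
  have key1 : ∀ u : R, IsUnit u → ∃ r : R, IsUnit r ∧ (u = r ^ 2 ∨ u = e * r ^ 2) := by
    intro u hu
    by_cases h : IsSquare (residue R u)
    · obtain ⟨r, hr⟩ := sq_lift h2 u hu h
      refine ⟨r, ?_, Or.inl hr⟩
      rw [hr] at hu
      exact (isUnit_pow_iff two_ne_zero).1 hu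
    · obtain ⟨v, hv⟩ := heu.mul hu
      have : IsSquare (residue R (e * u)) := by
        rw [map_mul]
        have h1 : residue R u ≠ 0 := (hu.map (residue R)).ne_zero
        have e1 := (quadraticChar_neg_one_iff_not_isSquare (F := ResidueField R)).2 he'
        have e2 := (quadraticChar_neg_one_iff_not_isSquare (F := ResidueField R)).2 h
        refine (quadraticChar_one_iff_isSquare (mul_ne_zero he0 h1)).1 ?_
        rw [map_mul, e1, e2]; norm_num
      obtain ⟨r, hr⟩ := sq_lift h2 (e * u) (heu.mul hu) this
      obtain ⟨f, hf⟩ := heu.exists_right_inv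
      have hru : IsUnit r := by
        have := heu.mul hu
        rw [hr] at this
        exact (isUnit_pow_iff two_ne_zero).1 this
      refine ⟨r * f, hru.mul (isUnit_of_mul_isUnit_right (hf ▸ isUnit_one)), Or.inr ?_⟩
      have : e * (r * f)^2 = u * (e * f)^2 := by rw [mul_pow, ← hr]; ring
      rw [this, hf]; ring
  -- class of elements of R
  have key2 : ∀ x : R, x ≠ 0 → ∃ r : R, r ≠ 0 ∧
    (x = r ^ 2 ∨ x = e * r ^ 2 ∨ x = π * r ^ 2 ∨ x = π * (e * r ^ 2)) := by
    intro x hx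
    obtain ⟨n, u, rfl⟩ := IsDiscreteValuationRing.eq_unit_mul_pow_irreducible hx hπ
    obtain ⟨r, hr, h⟩ := key1 u u.isUnit
    obtain ⟨m, hm⟩ := Nat.even_or_odd' n
    refine ⟨r * π ^ m, mul_ne_zero hr.ne_zero (pow_ne_zero _ hπ.ne_zero), ?_⟩
    rcases h with h | h <;> rcases hm with rfl | rfl <;> rw [h]
    · left; ring
    · right; right; left; ring
    · right; left; ring
    · right; right; right; ring
  have key3 : ∀ z : R, IsUnit (1 - e * z ^ 2) := by
    intro z
    rw [← isUnit_map_iff (residue R), isUnit_iff_ne_zero]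
    intro h
    simp only [map_sub, map_one, map_mul, map_pow] at h
    have hz : residue R z ≠ 0 := by rintro h0; simp [h0] at h
    apply he'
    refine ⟨(residue R z)⁻¹, ?_⟩
    field_simp
    linear_combination -h
  have key4 : ∀ z : R, IsUnit (z ^ 2 - e) := by
    intro z
    rw [← isUnit_map_iff (residue R), isUnit_iff_ne_zero]
    intro h
    simp only [map_sub, map_pow] at h
    apply he'
    refine ⟨(residue R z), ?_⟩
    linear_combination -h
  have key5 : ∀ x y : K, (x ≠ 0 ∨ y ≠ 0) → ∃ u : R, ∃ a : K, IsUnit u ∧ a ≠ 0 ∧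
      x ^ 2 - algebraMap R K e * y ^ 2 = algebraMap R K u * a ^ 2 := by
    intro x y hxy
    have hx : (∃ z : R, x ≠ 0 ∧ algebraMap R K z = y / x) ∨
        (∃ z : R, y ≠ 0 ∧ algebraMap R K z = x / y) := by
      by_cases hx : x = 0
      · right; exact ⟨0, by tauto, by simp [hx]⟩
      by_cases hy : y = 0
      · left; exact ⟨0, by tauto, by simp [hy]⟩
      rcases ValuationRing.isInteger_or_isInteger R (y / x) with ⟨z, hz⟩ | ⟨z, hz⟩
      · exact Or.inl ⟨z, hx, hz⟩
      · exact Or.inr ⟨z, hy, by rw [hz, inv_div]⟩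
    rcases hx with ⟨z, hx, hz⟩ | ⟨z, hx, hz⟩
    · refine ⟨_, x, key3 z, hx, ?_⟩
      simp only [map_sub, map_one, map_mul, map_pow, hz]
      field_simp
    · refine ⟨_, y, key4 z, hx, ?_⟩
      simp only [map_sub, map_pow, hz]
      field_simp
  have key6 : ∀ (u : R) (r : K), IsUnit u → algebraMap R K π = algebraMap R K u * r ^ 2 → False := by
    intro u r hu h
    have hr : ∃ r' : R, algebraMap R K r' = r := by
      rcases ValuationRing.isInteger_or_isInteger R r with ⟨z, hz⟩ | ⟨z, hz⟩
      · exact ⟨z, hz⟩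
      · by_cases hr : r = 0
        · exact ⟨0, by simp [hr]⟩
        exfalso
        have : u = π * z ^ 2 := by
          apply inj
          rw [map_mul, map_pow, h, hz]; field_simp
        rw [this] at hu
        exact hπ.not_isUnit (isUnit_of_mul_isUnit_left hu)
    obtain ⟨r, rfl⟩ := hr
    have h' : π = (u * r) * r := by apply inj; rw [h]; simp; ring
    rcases hπ.isUnit_or_isUnit h' with h1 | h1
    · have : IsUnit r := isUnit_of_mul_isUnit_right h1
      exact hπ.not_isUnit (h' ▸ h1.mul this)
    · exact hπ.not_isUnit (h' ▸ (hu.mul h1).mul h1)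
  -- solve s^2 - e t^2 = -1
  have key7 : ∃ s t : R, s ^ 2 - e * t ^ 2 = -1 := by
    obtain ⟨a, b, hab⟩ := FiniteField.exists_root_sum_quadratic
      (f := (Polynomial.X ^ 2 : Polynomial (ResidueField R)))
      (g := - Polynomial.C (residue R e) * Polynomial.X ^ 2 + Polynomial.C 0 * Polynomial.X + Polynomial.C 1)
      (by simp) (by
        have := Polynomial.degree_quadratic (a := - residue R e) (b := 0) (c := 1) (by simpa using he0)
        rw [← Polynomial.C_neg]; exact this)
      (FiniteField.odd_card_of_char_ne_two hchar)
    obtain ⟨b, rfl⟩ := residue_surjective b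
    simp at hab
    have hu : IsUnit (-1 + e * b ^ 2) := by
      have := (key3 b).neg
      convert this using 1; ring
    obtain ⟨s, hs⟩ := sq_lift h2 (-1 + e * b ^ 2) hu ⟨a, by simp; linear_combination -hab⟩
    exact ⟨s, b, by rw [← hs]; ring⟩
  obtain ⟨s, t, hst⟩ := key7
  refine ⟨algebraMap R K e, algebraMap R K π, algebraMap R K s, algebraMap R K t, ?_, ?_, ?_, ?_⟩
  · have := (h2.map (algebraMap R K)).ne_zero
    rwa [map_ofNat] at this
  · intro x hx
    obtain ⟨a, b, hb, rfl⟩ := IsFractionRing.div_surjective (A := R) x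
    have hb0 : b ≠ 0 := nonZeroDivisors.ne_zero hb
    have hb1 : algebraMap R K b ≠ 0 := by simpa using hb0
    have ha0 : a ≠ 0 := by rintro rfl; simp at hx
    obtain ⟨r, hr, h⟩ := key2 (a * b) (mul_ne_zero ha0 hb0)
    refine ⟨algebraMap R K r / algebraMap R K b, div_ne_zero (by simpa using hr) hb1, ?_⟩
    have h0 : algebraMap R K a / algebraMap R K b = algebraMap R K (a * b) / (algebraMap R K b)^2 := by
      rw [map_mul]; field_simp
    rw [h0]
    rcases h with h | h | h | h <;> rw [h]
    · left; simp; field_simp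
    · right; left; simp; field_simp
    · right; right; left; simp; field_simp
    · right; right; right; simp; field_simp
  · rw [← map_pow, ← map_pow, ← map_mul, ← map_sub, hst]; simp
  · intro x y z w h
    by_cases hxy : x ≠ 0 ∨ y ≠ 0
    · exfalso
      obtain ⟨u, a, hu, ha, h1⟩ := key5 x y hxy
      by_cases hzw : z ≠ 0 ∨ w ≠ 0
      · obtain ⟨v, b, hv, hb, h3⟩ := key5 z w hzw
        obtain ⟨v', hv'⟩ := hv.exists_right_inv
        rw [h1, h3] at h
        apply key6 (- u * v') (a / b) (hu.neg.mul (isUnit_of_mul_isUnit_right (hv' ▸ isUnit_one)))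
        have hv'' : algebraMap R K v * algebraMap R K v' = 1 := by rw [← map_mul, hv', map_one]
        simp only [map_mul, map_neg]
        field_simp
        linear_combination (algebraMap R K v') * h - algebraMap R K π * b^2 * hv''
      · push Not at hzw
        rw [h1, hzw.1, hzw.2] at h
        have := (hu.map (algebraMap R K)).ne_zero
        simp_all
    · push Not at hxy
      refine ⟨hxy.1, hxy.2, ?_⟩
      by_contra hzw
      obtain ⟨v, b, hv, hb, h3⟩ := key5 z w (by tauto)
      rw [hxy.1, hxy.2, h3] at h
      have := (hv.map (algebraMap R K)).ne_zero
      have := hπ.ne_zero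
      simp_all

open scoped NormedField Pointwise Valued in
theorem good_of_normed (K : Type) [NontriviallyNormedField K] [IsUltrametricDist K] [ProperSpace K]
    (h2 : ‖(2 : K)‖ = 1) : ∃ e π s t : K, GoodField K e π s t := by
  let hr : (Valued.v : Valuation K NNReal).RankOne :=
    inferInstanceAs (NormedField.valuation (K := K)).RankOne
  have hc : CompactSpace 𝒪[K] := by
    refine isCompact_iff_compactSpace.1 ?_
    convert isCompact_closedBall (0 : K) 1 using 1
    ext x
    simpa using Valued.integer.mem_iff (x := x)
  have hd : IsDiscreteValuationRing 𝒪[K] := Valued.integer.isDiscreteValuationRing_of_compactSpace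
  have hf : Finite 𝓀[K] :=
    (Valued.integer.compactSpace_iff_completeSpace_and_isDiscreteValuationRing_and_finite_residueField.mp hc).2.2
  have ha : IsAdicComplete 𝓂[K] 𝒪[K] :=
    { prec' f hf := by
        let S n : Set 𝒪[K] := f n +ᵥ ((𝓂[K] ^ n : Ideal 𝒪[K]) : Set 𝒪[K])
        have hS n : S (n + 1) ⊆ S n := by
          apply (Set.vadd_set_subset_vadd_set_iff.mpr (Ideal.pow_le_pow_right n.le_succ)).trans
          simpa [S] using (hf n.le_succ).symm
        have h n : IsClosed (S n) := (IsNoetherianRing.isClosed_ideal (𝓂[K] ^ n)).vadd (f n)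
        obtain ⟨L, hL⟩ := (h 0).isCompact.nonempty_iInter_of_sequence_nonempty_isCompact_isClosed S hS
          (by simp [S]) h
        refine ⟨L, fun n ↦ ?_⟩
        obtain ⟨y, hy, rfl⟩ := Set.mem_iInter.mp hL n
        simpa [SModEq.sub_mem] using hy }
  have h2' : IsUnit (2 : 𝒪[K]) := Valued.integer.isUnit_iff_norm_eq_one.2 h2
  exact good_of_dvr 𝒪[K] K h2'

theorem good_of_padic (p : ℕ) [Fact p.Prime] (hp : p ≠ 2) (K : Type) [Field K] [Algebra ℚ_[p] K]
    [FiniteDimensional ℚ_[p] K] : ∃ e π s t : K, GoodField K e π s t := by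
  have halg : Algebra.IsAlgebraic ℚ_[p] K := inferInstance
  let i1 : NontriviallyNormedField K := spectralNorm.nontriviallyNormedField ℚ_[p] K
  let i2 : NormedAlgebra ℚ_[p] K := spectralNorm.normedAlgebra ℚ_[p] K
  have i3 : IsUltrametricDist K := IsUltrametricDist.isUltrametricDist_of_isNonarchimedean_norm
    (isNonarchimedean_spectralNorm (K := ℚ_[p]) (L := K))
  have i4 : ProperSpace K := FiniteDimensional.proper ℚ_[p] K
  apply good_of_normed K
  have : ‖algebraMap ℚ_[p] K 2‖ = ‖(2 : ℚ_[p])‖ := norm_algebraMap' K 2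
  rw [map_ofNat] at this
  rw [this]
  have h := Padic.norm_natCast_eq_one_iff (p := p) (n := 2)
  simp only [Nat.cast_ofNat] at h
  rw [h]
  exact (Nat.coprime_primes Fact.out Nat.prime_two).2 hp

section Forms
open QuadraticMap

variable {F : Type} [Field F]

theorem QIsom.refl {M : Type} [AddCommGroup M] [Module F M] (Q : QuadraticForm F M) : QIsom Q Q :=
  ⟨LinearEquiv.refl _ _, fun _ => rfl⟩

theorem QIsom.symm {M M' : Type} [AddCommGroup M] [Module F M] [AddCommGroup M'] [Module F M']
    {Q : QuadraticForm F M} {Q' : QuadraticForm F M'} (h : QIsom Q Q') : QIsom Q' Q := by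
  obtain ⟨φ, hφ⟩ := h
  exact ⟨φ.symm, fun x => by rw [← hφ]; simp⟩

theorem QIsom.trans {M M' M'' : Type} [AddCommGroup M] [Module F M] [AddCommGroup M'] [Module F M']
    [AddCommGroup M''] [Module F M'']
    {Q : QuadraticForm F M} {Q' : QuadraticForm F M'} {Q'' : QuadraticForm F M''}
    (h : QIsom Q Q') (h' : QIsom Q' Q'') : QIsom Q Q'' := by
  obtain ⟨φ, hφ⟩ := h
  obtain ⟨ψ, hψ⟩ := h'
  exact ⟨φ.trans ψ, fun x => by simp [hφ, hψ]⟩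

theorem QIsom.prod {M M' N N' : Type} [AddCommGroup M] [Module F M] [AddCommGroup M'] [Module F M']
    [AddCommGroup N] [Module F N] [AddCommGroup N'] [Module F N']
    {Q : QuadraticForm F M} {Q' : QuadraticForm F M'} {P : QuadraticForm F N}
    {P' : QuadraticForm F N'}
    (h : QIsom Q Q') (h' : QIsom P P') : QIsom (Q.prod P) (Q'.prod P') := by
  obtain ⟨φ, hφ⟩ := h
  obtain ⟨ψ, hψ⟩ := h'
  exact ⟨φ.prodCongr ψ, fun x => by simp [hφ, hψ]⟩

theorem QIsom.neg {M M' : Type} [AddCommGroup M] [Module F M] [AddCommGroup M'] [Module F M']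
    {Q : QuadraticForm F M} {Q' : QuadraticForm F M'}
    (h : QIsom Q Q') : QIsom (-Q) (-Q') := by
  obtain ⟨φ, hφ⟩ := h
  exact ⟨φ, fun x => by simp [hφ]⟩

theorem QIsom.prodAssoc {M M' M'' : Type} [AddCommGroup M] [Module F M] [AddCommGroup M']
    [Module F M'] [AddCommGroup M''] [Module F M'']
    (Q : QuadraticForm F M) (Q' : QuadraticForm F M') (Q'' : QuadraticForm F M'') :
    QIsom ((Q.prod Q').prod Q'') (Q.prod (Q'.prod Q'')) :=
  ⟨LinearEquiv.prodAssoc F M M' M'', fun x => by simp [add_assoc]⟩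

theorem QIsom.prodComm {M M' : Type} [AddCommGroup M] [Module F M] [AddCommGroup M']
    [Module F M'] (Q : QuadraticForm F M) (Q' : QuadraticForm F M') :
    QIsom (Q.prod Q') (Q'.prod Q) :=
  ⟨LinearEquiv.prodComm F M M', fun x => by simp [add_comm]⟩

theorem QIsom.anisotropic {M M' : Type} [AddCommGroup M] [Module F M] [AddCommGroup M']
    [Module F M'] {Q : QuadraticForm F M} {Q' : QuadraticForm F M'} (h : QIsom Q Q')
    (ha : Q.Anisotropic) : Q'.Anisotropic := by
  obtain ⟨φ, hφ⟩ := h.symm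
  intro x hx
  have := ha (φ x) (by rw [hφ, hx])
  simpa using this

/-- One-dimensional form. -/
noncomputable def oneForm (a : F) : QuadraticForm F F := a • QuadraticMap.sq

theorem oneForm_apply (a x : F) : oneForm a x = a * x ^ 2 := by simp [oneForm, pow_two]

/-- Diagonal form of a list. -/
noncomputable def diagL (l : List F) : QuadraticForm F (Fin l.length → F) :=
  QuadraticMap.weightedSumSquares F l.get

theorem diagL_apply (l : List F) (x : Fin l.length → F) :
    diagL l x = ∑ i, l.get i * x i ^ 2 := by
  simp [diagL, QuadraticMap.weightedSumSquares_apply, pow_two]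

theorem diagL_cons_apply (a : F) (l : List F) (x : Fin (a :: l).length → F) :
    diagL (a :: l) x = a * x 0 ^ 2 + diagL l (fun i => x i.succ) := by
  rw [diagL_apply, diagL_apply]
  exact Fin.sum_univ_succ (n := l.length) _

theorem diagL_cons (a : F) (l : List F) : QIsom (diagL (a :: l)) ((oneForm a).prod (diagL l)) := by
  refine ⟨(Fin.consLinearEquiv F (fun _ : Fin (l.length + 1) => F)).symm, fun x => ?_⟩
  rw [diagL_cons_apply, QuadraticMap.prod_apply, oneForm_apply]
  rfl

/-- Isometry of lists. -/
def LIso (l l' : List F) : Prop := QIsom (diagL l) (diagL l')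

theorem LIso.refl (l : List F) : LIso l l := QIsom.refl _
theorem LIso.symm {l l' : List F} (h : LIso l l') : LIso l' l := QIsom.symm h
theorem LIso.trans {l l' l'' : List F} (h : LIso l l') (h' : LIso l' l'') : LIso l l'' :=
  QIsom.trans h h'

theorem LIso.cons (a : F) {l l' : List F} (h : LIso l l') : LIso (a :: l) (a :: l') :=
  (diagL_cons a l).trans (((QIsom.refl _).prod h).trans (diagL_cons a l').symm)

theorem LIso.scale (a r : F) (hr : r ≠ 0) (l : List F) : LIso (a * r ^ 2 :: l) (a :: l) := by
  refine (diagL_cons _ l).trans ((QIsom.prod ?_ (QIsom.refl _)).trans (diagL_cons a l).symm)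
  refine ⟨LinearEquiv.smulOfNeZero F F r hr, fun x => ?_⟩
  simp [oneForm_apply]; ring

theorem LIso.binary {x y x' y' : F} (α β γ δ : F) (h1 : α ^ 2 * x' + γ ^ 2 * y' = x)
    (h2 : α * β * x' + γ * δ * y' = 0) (h3 : β ^ 2 * x' + δ ^ 2 * y' = y)
    (hd : α * δ - β * γ ≠ 0) (l : List F) : LIso (x :: y :: l) (x' :: y' :: l) := by
  have key : ∀ a b : F, QIsom (diagL (a :: b :: l)) (((oneForm a).prod (oneForm b)).prod (diagL l)) :=
    fun a b => ((diagL_cons a _).trans ((QIsom.refl _).prod (diagL_cons b l))).trans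
      (QIsom.prodAssoc _ _ _).symm
  refine (key x y).trans ((QIsom.prod ?_ (QIsom.refl _)).trans (key x' y').symm)
  have hd1 : (α * δ - β * γ)⁻¹ * (α * δ - β * γ) = 1 := inv_mul_cancel₀ hd
  set D := (α * δ - β * γ)⁻¹
  refine ⟨{ toFun := fun p => (α * p.1 + β * p.2, γ * p.1 + δ * p.2)
            invFun := fun p => (D * (δ * p.1 - β * p.2), D * (α * p.2 - γ * p.1))
            map_add' := ?_
            map_smul' := ?_
            left_inv := ?_
            right_inv := ?_ }, ?_⟩
  · intro p q; ext <;> simp <;> ring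
  · intro r q; ext <;> simp <;> ring
  · rintro ⟨p, q⟩; ext
    · simp; linear_combination p * hd1
    · simp; linear_combination q * hd1
  · rintro ⟨p, q⟩; ext
    · simp; linear_combination p * hd1
    · simp; linear_combination q * hd1
  · rintro ⟨p, q⟩
    simp [oneForm_apply]
    linear_combination p ^ 2 * h1 + 2 * p * q * h2 + q ^ 2 * h3

theorem LIso.swap (a b : F) (l : List F) : LIso (a :: b :: l) (b :: a :: l) :=
  LIso.binary 0 1 1 0 (by ring) (by ring) (by ring) (by simp) l

theorem LIso.perm {l l' : List F} (h : l.Perm l') : LIso l l' := by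
  induction h with
  | nil => exact LIso.refl _
  | cons a _ ih => exact ih.cons a
  | swap a b l => exact LIso.swap b a l
  | trans _ _ h1 h2 => exact h1.trans h2

theorem LIso.append_left (l : List F) {m m' : List F} (h : LIso m m') : LIso (l ++ m) (l ++ m') := by
  induction l with
  | nil => exact h
  | cons a l ih => exact ih.cons a

theorem LIso.append {l l' m m' : List F} (h : LIso l l') (h' : LIso m m') :
    LIso (l ++ m) (l' ++ m') :=
  (LIso.append_left l h').trans ((LIso.perm List.perm_append_comm).trans
    ((LIso.append_left m' h).trans (LIso.perm List.perm_append_comm)))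

theorem LIso.hyp (h2 : (2 : F) ≠ 0) (a : F) (ha : a ≠ 0) (l : List F) :
    LIso (a :: -a :: l) (1 :: -1 :: l) := by
  refine LIso.binary ((a + 1) / 2) ((a - 1) / 2) ((a - 1) / 2) ((a + 1) / 2) ?_ ?_ ?_ ?_ l
  · field_simp; ring
  · field_simp; ring
  · field_simp; ring
  · have : (a + 1) / 2 * ((a + 1) / 2) - (a - 1) / 2 * ((a - 1) / 2) = a := by field_simp; ring
    rwa [this]

theorem diagL_map (f : F → F) (c : F) (hf : ∀ x, f x = c * x) (l : List F) :
    QIsom (diagL (l.map f)) (c • diagL l) := by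
  refine ⟨LinearEquiv.funCongrLeft F F (finCongr (by simp)).symm.symm.symm, fun x => ?_⟩
  rw [_root_.smul_apply, diagL_apply, diagL_apply, smul_eq_mul, Finset.mul_sum]
  refine Fintype.sum_equiv (finCongr (by simp)) _ _ fun i => ?_
  simp [hf, LinearMap.funLeft]
  ring

theorem QIsom.smul {M M' : Type} [AddCommGroup M] [Module F M] [AddCommGroup M'] [Module F M']
    {Q : QuadraticForm F M} {Q' : QuadraticForm F M'} (c : F)
    (h : QIsom Q Q') : QIsom (c • Q) (c • Q') := by
  obtain ⟨φ, hφ⟩ := h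
  exact ⟨φ, fun x => by simp [hφ]⟩

theorem LIso.map_mul (c : F) {l l' : List F} (h : LIso l l') :
    LIso (l.map (c * ·)) (l'.map (c * ·)) :=
  (diagL_map _ c (fun _ => rfl) l).trans ((QIsom.smul c h).trans
    (diagL_map _ c (fun _ => rfl) l').symm)

theorem diagL_neg (l : List F) : QIsom (-(diagL l)) (diagL (l.map (fun x => -x))) := by
  have := (diagL_map (fun x => -x) (-1) (fun _ => by ring) l).symm
  have e : (-1 : F) • diagL l = -(diagL l) := by ext x; simp
  rwa [e] at this

theorem QIsom.nil_prod {M : Type} [AddCommGroup M] [Module F M] (Q : QuadraticForm F M) :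
    QIsom Q ((diagL ([] : List F)).prod Q) := by
  refine ⟨{ toFun := fun x => (0, x), invFun := fun p => p.2, map_add' := by intro x y; ext i <;> simp
            map_smul' := by
              intro x y
              ext i
              · exact i.elim0
              · simp
            left_inv := fun _ => rfl, right_inv := ?_ }, ?_⟩
  · rintro ⟨a, b⟩
    ext i
    · exact i.elim0
    · rfl
  · intro x; simp

theorem diagL_append (l l' : List F) : QIsom (diagL (l ++ l')) ((diagL l).prod (diagL l')) := by
  induction l with
  | nil => exact QIsom.nil_prod _
  | cons a l ih =>
    refine (diagL_cons a (l ++ l')).trans (((QIsom.refl _).prod ih).trans ?_)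
    exact (QIsom.prodAssoc _ _ _).symm.trans ((diagL_cons a l).symm.prod (QIsom.refl _))

/-- List of hyperbolic planes. -/
def hs (F : Type) [Field F] : ℕ → List F
  | 0 => []
  | n + 1 => 1 :: -1 :: hs F n

theorem hs_add (m n : ℕ) : hs F (m + n) = hs F m ++ hs F n := by
  induction m with
  | zero => simp [hs]
  | succ m ih => rw [Nat.succ_add]; simp [hs, ih]

theorem hypForm_iso (h2 : (2 : F) ≠ 0) :
    QIsom ((oneForm (1 : F)).prod (oneForm (-1))) (HypForm F) := by
  refine ⟨{ toFun := fun p => (p.1 + p.2, p.1 - p.2)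
            invFun := fun p => ((p.1 + p.2) / 2, (p.1 - p.2) / 2)
            map_add' := ?_
            map_smul' := ?_
            left_inv := ?_
            right_inv := ?_ }, ?_⟩
  · intro p q; ext <;> simp <;> ring
  · intro r q; ext <;> simp <;> ring
  · rintro ⟨p, q⟩; ext <;> simp <;> field_simp <;> ring
  · rintro ⟨p, q⟩; ext <;> simp <;> field_simp <;> ring
  · rintro ⟨p, q⟩
    simp [oneForm_apply, HypForm]
    ring

theorem hypSum_apply (n : ℕ) (x : Fin n → F × F) : HypSum F n x = ∑ i, (x i).1 * (x i).2 := by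
  simp [HypSum, HypForm, QuadraticMap.pi_apply]

theorem hypSum_succ (n : ℕ) : QIsom (HypSum F (n + 1)) ((HypForm F).prod (HypSum F n)) := by
  refine ⟨(Fin.consLinearEquiv F (fun _ : Fin (n + 1) => F × F)).symm, fun x => ?_⟩
  rw [QuadraticMap.prod_apply, hypSum_apply, hypSum_apply, Fin.sum_univ_succ]
  simp [HypForm]
  rfl

theorem hs_iso (h2 : (2 : F) ≠ 0) (n : ℕ) : QIsom (diagL (hs F n)) (HypSum F n) := by
  induction n with
  | zero =>
    refine ⟨{ toFun := fun _ => 0, invFun := fun _ => 0, map_add' := by simp, map_smul' := by simp,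
              left_inv := ?_, right_inv := ?_ }, ?_⟩
    · intro x; ext i; exact i.elim0
    · intro x; ext i <;> exact i.elim0
    · intro x
      rw [diagL_apply, hypSum_apply, Finset.univ_eq_empty, Finset.sum_empty]
      symm
      exact Finset.sum_eq_zero fun i _ => i.elim0
  | succ n ih =>
    refine (diagL_append [1, -1] (hs F n)).trans ((QIsom.prod ?_ ih).trans (hypSum_succ n).symm)
    refine ((diagL_cons _ _).trans ((QIsom.refl _).prod ?_)).trans (hypForm_iso h2)
    exact (diagL_cons _ _).trans ((QIsom.prodComm _ _).trans (QIsom.nil_prod _).symm)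

theorem hs_append_iso (h2 : (2 : F) ≠ 0) (n : ℕ) (m : List F) :
    QIsom (diagL (hs F n ++ m)) ((diagL m).prod (HypSum F n)) :=
  (diagL_append _ _).trans (((hs_iso h2 n).prod (QIsom.refl _)).trans (QIsom.prodComm _ _))

end Forms

section Dim
variable {F : Type} [Field F]

theorem isotropic_bound {M : Type} [AddCommGroup M] [Module F M]
    (w : QuadraticForm F M) (hw : w.Anisotropic) (a b : ℕ)
    (g : (Fin b → F) →ₗ[F] (M × (Fin a → F × F))) (hg : Function.Injective g)
    (h0 : ∀ x, (w.prod (HypSum F a)) (g x) = 0) : b ≤ a := by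
  let f : (Fin b → F) →ₗ[F] (Fin a → F) :=
    { toFun := fun v i => ((g v).2 i).1
      map_add' := by intro x y; ext i; simp
      map_smul' := by intro x y; ext i; simp }
  let h : (Fin b → F) →ₗ[F] (Fin a → F) :=
    { toFun := fun v i => ((g v).2 i).2
      map_add' := by intro x y; ext i; simp
      map_smul' := by intro x y; ext i; simp }
  have hQ : ∀ v, w (g v).1 + ∑ i, f v i * h v i = 0 := by
    intro v
    have := h0 v
    rw [QuadraticMap.prod_apply, hypSum_apply] at this
    exact this
  have k1 : ∀ v, f v = 0 → (g v).1 = 0 := by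
    intro v hv
    have := hQ v
    rw [hv] at this
    simp at this
    exact hw _ this
  have k2 : ∀ v v0, f v0 = 0 → ∑ i, f v i * h v0 i = 0 := by
    intro v v0 hv
    have e1 := hQ (v + v0)
    have e2 := hQ v
    have e3 : (g (v + v0)).1 = (g v).1 := by simp [k1 v0 hv]
    rw [e3, map_add, map_add, hv, add_zero] at e1
    simp only [Pi.add_apply, mul_add, Finset.sum_add_distrib] at e1
    linear_combination e1 - e2
  let X : Submodule F (Fin a → F) := LinearMap.range f
  let Y : Submodule F (Fin a → F) := (LinearMap.ker f).map h
  have hY : Module.finrank F Y = Module.finrank F (LinearMap.ker f) := by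
    have hinj : Function.Injective (h.comp (LinearMap.ker f).subtype) := by
      rw [← LinearMap.ker_eq_bot, LinearMap.ker_eq_bot']
      rintro ⟨v, hv⟩ hv2
      have hv' : f v = 0 := hv
      have hv2' : h v = 0 := hv2
      have : g v = 0 := by
        ext i
        · exact k1 v hv'
        · exact congrFun hv' i
        · exact congrFun hv2' i
      have : v = 0 := hg (by rw [this, map_zero])
      exact Subtype.ext this
    have := LinearMap.finrank_range_of_inj hinj
    rw [LinearMap.range_comp, Submodule.range_subtype] at this
    exact this
  have hle : X.map (dotProductEquiv F (Fin a)).toLinearMap ≤ Y.dualAnnihilator := by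
    rintro _ ⟨_, ⟨v, rfl⟩, rfl⟩
    rw [Submodule.mem_dualAnnihilator]
    rintro _ ⟨v0, hv0, rfl⟩
    have := k2 v v0 hv0
    simpa [dotProduct] using this
  have e1 := Submodule.finrank_mono hle
  have e2 : Module.finrank F (X.map (dotProductEquiv F (Fin a)).toLinearMap) = Module.finrank F X :=
    LinearEquiv.finrank_map_eq _ _
  have e3 := Subspace.finrank_add_finrank_dualAnnihilator_eq Y
  have e4 := LinearMap.finrank_range_add_finrank_ker f
  have e5 : Module.finrank F X = Module.finrank F (LinearMap.range f) := rfl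
  simp at e3 e4
  omega

theorem witt_index_le {M M' : Type} [AddCommGroup M] [Module F M]
    [AddCommGroup M'] [Module F M']
    (w : QuadraticForm F M) (w' : QuadraticForm F M') (hw : w.Anisotropic) (a b : ℕ)
    (h : QIsom (w.prod (HypSum F a)) (w'.prod (HypSum F b))) : b ≤ a := by
  obtain ⟨φ, hφ⟩ := h.symm
  let k : (Fin b → F) →ₗ[F] (M' × (Fin b → F × F)) :=
    { toFun := fun v => (0, fun i => (v i, 0))
      map_add' := by intro x y; ext i <;> simp
      map_smul' := by intro x y; ext i <;> simp }
  refine isotropic_bound w hw a b (φ.toLinearMap.comp k) (φ.injective.comp ?_) ?_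
  · intro x y hxy
    ext i
    exact congrArg (fun p => (p.2 i).1) hxy
  · intro x
    rw [LinearMap.comp_apply, LinearEquiv.coe_coe, hφ, QuadraticMap.prod_apply, hypSum_apply]
    simp [k]

theorem witt_dim {d d' : ℕ} (w : QuadraticForm F (Fin d → F)) (w' : QuadraticForm F (Fin d' → F))
    (hw : w.Anisotropic) (hw' : w'.Anisotropic) (a b : ℕ)
    (h : QIsom (w.prod (HypSum F a)) (w'.prod (HypSum F b))) : d = d' := by
  have h1 := witt_index_le w w' hw a b h
  have h2 := witt_index_le w' w hw' b a h.symm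
  obtain rfl : a = b := le_antisymm h2 h1
  obtain ⟨φ, -⟩ := h
  have := φ.finrank_eq
  simp at this
  exact this

end Dim

section Table
variable {F : Type} [Field F]

/-- The four residue forms. -/
def cl (e : F) : Fin 4 → List F := ![[], [1], [1, -e], [e]]

/-- Cyclic distance. -/
def dd : Fin 4 → Fin 4 → ℕ := ![![0, 1, 2, 1], ![1, 0, 1, 2], ![2, 1, 0, 1], ![1, 2, 1, 0]]

/-- `diagL m` embeds in the norm form. -/
def SubN (e : F) (m : List F) : Prop :=
  ∀ x : Fin m.length → F, ∃ a b : F, diagL m x = a ^ 2 - e * b ^ 2 ∧ (a = 0 → b = 0 → x = 0)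

theorem SubN.nil (e : F) : SubN e [] := by
  intro x
  refine ⟨0, 0, ?_, fun _ _ => ?_⟩
  · rw [diagL_apply, Finset.sum_eq_zero fun i _ => i.elim0]; ring
  · ext i; exact i.elim0

theorem SubN.one (e c u v : F) (hc : c = u ^ 2 - e * v ^ 2) (h0 : u ≠ 0 ∨ v ≠ 0) : SubN e [c] := by
  intro x
  refine ⟨u * x 0, v * x 0, ?_, fun h1 h2 => ?_⟩
  · rw [diagL_cons_apply, diagL_apply, Finset.sum_eq_zero fun i _ => i.elim0, hc]; ring
  · ext i
    have : i = 0 := Fin.ext (by have := i.2; simp at this; simpa using this)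
    subst this
    rcases h0 with h | h
    · simpa [h] using h1
    · simpa [h] using h2

theorem SubN.two (e c c' α β γ δ : F)
    (h1 : α ^ 2 - e * γ ^ 2 = c)
    (h2 : α * β - e * γ * δ = 0) (h3 : β ^ 2 - e * δ ^ 2 = c')
    (hd : α * δ - β * γ ≠ 0) : SubN e [c, c'] := by
  intro x
  refine ⟨α * x 0 + β * x 1, γ * x 0 + δ * x 1, ?_, fun k1 k2 => ?_⟩
  · rw [diagL_cons_apply, diagL_cons_apply, diagL_apply, Finset.sum_eq_zero fun i _ => i.elim0]
    have : (Fin.succ 0 : Fin (c :: [c']).length) = 1 := rfl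
    rw [this]
    linear_combination -(x 0) ^ 2 * h1 - 2 * x 0 * x 1 * h2 - (x 1) ^ 2 * h3
  · have e0 : (α * δ - β * γ) * x 0 = 0 := by linear_combination δ * k1 - β * k2
    have e1 : (α * δ - β * γ) * x 1 = 0 := by linear_combination α * k2 - γ * k1
    ext i
    have : i = 0 ∨ i = 1 := by
      have := i.2
      simp at this
      rcases (by omega : i.1 = 0 ∨ i.1 = 1) with h | h
      · left; exact Fin.ext h
      · right; exact Fin.ext h
    rcases this with rfl | rfl
    · simpa [hd] using e0
    · simpa [hd] using e1

/-- Bundled form of `GoodField`. -/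
structure Gd (F : Type) [Field F] (e π s t : F) : Prop where
  two : (2 : F) ≠ 0
  cls : ∀ x : F, x ≠ 0 → ∃ r : F, r ≠ 0 ∧
    (x = r ^ 2 ∨ x = e * r ^ 2 ∨ x = π * r ^ 2 ∨ x = π * (e * r ^ 2))
  st : s ^ 2 - e * t ^ 2 = -1
  ani : ∀ x y z w : F, x ^ 2 - e * y ^ 2 + π * (z ^ 2 - e * w ^ 2) = 0 →
    x = 0 ∧ y = 0 ∧ z = 0 ∧ w = 0

variable {e π s t : F}

theorem Gd.e0 (G : Gd F e π s t) : e ≠ 0 := by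
  rintro rfl
  simpa using G.ani 0 1 0 0

theorem Gd.π0 (G : Gd F e π s t) : π ≠ 0 := by
  rintro rfl
  simpa using G.ani 0 0 1 0

theorem Gd.st0 (G : Gd F e π s t) : s ≠ 0 ∨ t ≠ 0 := by
  by_contra h
  push Not at h
  have := G.st
  simp [h.1, h.2] at this

theorem Gd.D (G : Gd F e π s t) : ∃ r : F, r ≠ 0 ∧ (r ^ 2 = -1 ∨ e * r ^ 2 = -1) := by
  obtain ⟨r, hr, h⟩ := G.cls (-1) (by simp)
  refine ⟨r, hr, ?_⟩
  rcases h with h | h | h | h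
  · exact Or.inl h.symm
  · exact Or.inr h.symm
  · have := G.ani 1 0 r 0 (by linear_combination -h)
    exact absurd this.1 one_ne_zero
  · have := G.ani 1 0 (e * t * r) (s * r) (by
      linear_combination -h - π * e * r ^ 2 * G.st)
    exact absurd this.1 one_ne_zero

theorem Gd.N (G : Gd F e π s t) (l : List F) : LIso (1 :: -e :: l) (-1 :: e :: l) := by
  refine LIso.binary s (e * t) t s ?_ ?_ ?_ ?_ l
  · linear_combination -G.st
  · ring
  · linear_combination e * G.st
  · have : s * s - e * t * t = -1 := by linear_combination G.st
    rw [this]; simp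

theorem Gd.anis (G : Gd F e π s t) {m m' : List F} (h : SubN e m) (h' : SubN e m') :
    (diagL (m ++ m'.map (π * ·))).Anisotropic := by
  have h1 : QIsom ((diagL m).prod (π • diagL m')) (diagL (m ++ m'.map (π * ·))) :=
    (((QIsom.refl _).prod (diagL_map _ π (fun _ => rfl) m').symm)).trans (diagL_append _ _).symm
  refine h1.anisotropic ?_
  rintro ⟨x, y⟩ hxy
  obtain ⟨a, b, hab, h0⟩ := h x
  obtain ⟨c, d, hcd, h0'⟩ := h' y
  simp [hab, hcd] at hxy
  obtain ⟨rfl, rfl, rfl, rfl⟩ := G.ani _ _ _ _ hxy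
  simp [h0, h0']

theorem Gd.subN_cl (G : Gd F e π s t) (i : Fin 4) : SubN e (cl e i) := by
  have hst : e = (e * t) ^ 2 - e * s ^ 2 := by linear_combination e * G.st
  have h0 : e * t ≠ 0 ∨ s ≠ 0 := by
    rcases G.st0 with h | h
    · exact Or.inr h
    · exact Or.inl (mul_ne_zero G.e0 h)
  fin_cases i
  · exact SubN.nil e
  · exact SubN.one e 1 1 0 (by ring) (by simp)
  · exact SubN.two e 1 (-e) 1 0 0 1 (by ring) (by ring) (by ring) (by simp)
  · exact SubN.one e e (e * t) s hst h0

theorem Gd.table (G : Gd F e π s t) (i j : Fin 4) : ∃ (n : ℕ) (m : List F),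
    LIso (cl e i ++ (cl e j).map (fun x => -x)) (hs F n ++ m) ∧ m.length = dd i j ∧ SubN e m := by
  have hst : e = (e * t) ^ 2 - e * s ^ 2 := by linear_combination e * G.st
  have h0 : e * t ≠ 0 ∨ s ≠ 0 := by
    rcases G.st0 with h | h
    · exact Or.inr h
    · exact Or.inl (mul_ne_zero G.e0 h)
  have S1 : SubN e [1] := G.subN_cl 1
  have S2 : SubN e [1, -e] := G.subN_cl 2
  have Se : SubN e [e] := G.subN_cl 3
  have Sm1 : SubN e [-1] := SubN.one e (-1) s t G.st.symm G.st0
  have Sme : SubN e [-e] := SubN.one e (-e) 0 1 (by ring) (by simp)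
  have hdet : s * s - e * t * t ≠ 0 := by
    have : s * s - e * t * t = -1 := by linear_combination G.st
    rw [this]; simp
  have hdet' : e * t * t - s * s ≠ 0 := by
    have : e * t * t - s * s = 1 := by linear_combination -G.st
    rw [this]; simp
  have S2' : SubN e [-1, e] :=
    SubN.two e (-1) e s (e * t) t s G.st (by ring) hst.symm hdet
  have S2'' : SubN e [e, -1] :=
    SubN.two e e (-1) (e * t) s s t hst.symm (by ring) G.st hdet'
  have hyp := LIso.hyp G.two
  fin_cases i <;> fin_cases j
  · exact ⟨0, [], LIso.refl _, rfl, SubN.nil e⟩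
  · exact ⟨0, [-1], LIso.refl _, rfl, Sm1⟩
  · refine ⟨0, [-1, e], ?_, rfl, S2'⟩
    simp [cl, hs]
    exact LIso.refl _
  · exact ⟨0, [-e], LIso.refl _, rfl, Sme⟩
  · exact ⟨0, [1], LIso.refl _, rfl, S1⟩
  · exact ⟨1, [], LIso.refl _, rfl, SubN.nil e⟩
  · refine ⟨1, [e], ?_, rfl, Se⟩
    simp [cl, hs]
    exact LIso.refl _
  · exact ⟨0, [1, -e], LIso.refl _, rfl, S2⟩
  · exact ⟨0, [1, -e], LIso.refl _, rfl, S2⟩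
  · exact ⟨1, [-e], (LIso.swap _ _ _).cons _, rfl, Sme⟩
  · refine ⟨2, [], ?_, rfl, SubN.nil e⟩
    simp [cl, hs]
    refine ((LIso.swap _ _ _).cons _).trans (LIso.cons _ (LIso.cons _ ?_))
    exact (LIso.swap _ _ _).trans (hyp e G.e0 _)
  · refine ⟨1, [-1], ?_, rfl, Sm1⟩
    simp only [cl, hs]
    refine (G.N _).trans ((LIso.cons _ (hyp e G.e0 _)).trans ?_)
    exact (LIso.swap _ _ _).trans (LIso.cons _ (LIso.refl _))
  · exact ⟨0, [e], LIso.refl _, rfl, Se⟩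
  · exact ⟨0, [e, -1], LIso.refl _, rfl, S2''⟩
  · refine ⟨1, [1], ?_, rfl, S1⟩
    simp [cl, hs]
    refine (LIso.swap _ _ _).trans ((G.N _).symm.trans ?_)
    refine (LIso.cons _ ((LIso.swap _ _ _).trans (hyp e G.e0 _))).trans ?_
    exact LIso.cons _ (LIso.swap _ _ _)
  · exact ⟨1, [], hyp e G.e0 _, rfl, SubN.nil e⟩

theorem Gd.step (G : Gd F e π s t) (c : F) (hc : c = 1 ∨ c = e) (i : Fin 4) :
    (∃ i', LIso (c :: cl e i) (cl e i')) ∨ (∃ m, LIso (c :: cl e i) (1 :: -1 :: m)) := by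
  obtain ⟨r, hr, hD⟩ := G.D
  have hyp := LIso.hyp G.two
  have hdiv : ∀ a b : F, a = b * r ^ 2 → ∀ l : List F, LIso (a :: l) (b :: l) := by
    rintro a b rfl l; exact LIso.scale b r hr l
  have h1e : (∃ i', LIso [1, e] (cl e i')) ∨ (∃ m, LIso [1, e] (1 :: -1 :: m)) := by
    rcases hD with hD | hD
    · exact Or.inl ⟨2, LIso.cons _ (hdiv e (-e) (by rw [hD]; ring) _)⟩
    · exact Or.inr ⟨[], LIso.cons _ (LIso.symm (hdiv (-1) e hD.symm _))⟩
  rcases hc with rfl | rfl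
  · fin_cases i
    · exact Or.inl ⟨1, LIso.refl _⟩
    · rcases hD with hD | hD
      · exact Or.inr ⟨[], LIso.cons _ (hdiv 1 (-1) (by rw [hD]; ring) _)⟩
      · exact Or.inl ⟨2, LIso.cons _ (hdiv 1 (-e) (by linear_combination hD) _)⟩
    · exact Or.inr ⟨[e], LIso.cons _ (G.N _)⟩
    · exact h1e
  · fin_cases i
    · exact Or.inl ⟨3, LIso.refl _⟩
    · rcases h1e with ⟨i', h⟩ | ⟨m, h⟩
      · exact Or.inl ⟨i', (LIso.swap _ _ _).trans h⟩
      · exact Or.inr ⟨m, (LIso.swap _ _ _).trans h⟩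
    · exact Or.inr ⟨[1], (LIso.cons _ (LIso.swap _ _ _)).trans (hyp c G.e0 _)⟩
    · rcases hD with hD | hD
      · exact Or.inr ⟨[], (LIso.cons _ (hdiv c (-c) (by rw [hD]; ring) _)).trans (hyp c G.e0 _)⟩
      · refine Or.inl ⟨2, ?_⟩
        refine (LIso.cons _ (LIso.symm (hdiv (-1) c hD.symm _))).trans ?_
        exact (LIso.swap _ _ _).trans (G.N _).symm

/-- The sixteen forms. -/
def cl2 (e π : F) (i : Fin 4 × Fin 4) : List F := cl e i.1 ++ (cl e i.2).map (π * ·)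

theorem not_anis_hyp {l m : List F} (h : LIso l (1 :: -1 :: m)) : ¬ (diagL l).Anisotropic := by
  intro ha
  have ha' := QIsom.anisotropic (QIsom.trans h (diagL_append [1, -1] m)) ha
  have := ha' (fun _ => 1, 0) (by
    rw [QuadraticMap.prod_apply, diagL_cons_apply, diagL_cons_apply, diagL_apply,
      Finset.sum_eq_zero fun i _ => i.elim0]
    simp)
  have := congrFun (congrArg Prod.fst this) 0
  simp at this

theorem anis_of_cons {a : F} {l : List F} (h : (diagL (a :: l)).Anisotropic) :
    a ≠ 0 ∧ (diagL l).Anisotropic := by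
  have h' := QIsom.anisotropic (diagL_cons a l) h
  constructor
  · rintro rfl
    have := h' (1, 0) (by simp [oneForm_apply])
    simpa using congrArg Prod.fst this
  · intro x hx
    have := h' (0, x) (by simp [hx])
    exact congrArg Prod.snd this

theorem Gd.classify (G : Gd F e π s t) (l : List F) (hl : (diagL l).Anisotropic) :
    ∃ i, LIso l (cl2 e π i) := by
  induction l with
  | nil => exact ⟨(0, 0), LIso.refl _⟩
  | cons a l ih =>
    obtain ⟨ha, hl'⟩ := anis_of_cons hl
    obtain ⟨⟨i, j⟩, hi⟩ := ih hl'
    obtain ⟨r, hr, h⟩ := G.cls a ha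
    have hc : ∃ c, (c = 1 ∨ c = e) ∧ (a = c * r ^ 2 ∨ a = (π * c) * r ^ 2) := by
      rcases h with h | h | h | h
      · exact ⟨1, Or.inl rfl, Or.inl (by rw [h]; ring)⟩
      · exact ⟨e, Or.inr rfl, Or.inl h⟩
      · exact ⟨1, Or.inl rfl, Or.inr (by rw [h]; ring)⟩
      · exact ⟨e, Or.inr rfl, Or.inr (by rw [h]; ring)⟩
    obtain ⟨c, hc, h⟩ := hc
    rcases h with rfl | rfl
    · have k := (LIso.scale c r hr l).trans (hi.cons c)
      rcases G.step c hc i with ⟨i', h'⟩ | ⟨m, h'⟩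
      · exact ⟨(i', j), k.trans (LIso.append h' (LIso.refl _))⟩
      · exact absurd hl (not_anis_hyp (k.trans
          (LIso.append (l := c :: cl e i) (l' := 1 :: -1 :: m) h' (LIso.refl _))))
    · have k := (LIso.scale (π * c) r hr l).trans (hi.cons (π * c))
      have k' : LIso (π * c :: cl2 e π (i, j)) (cl e i ++ (c :: cl e j).map (π * ·)) :=
        LIso.perm List.perm_middle.symm
      rcases G.step c hc j with ⟨j', h'⟩ | ⟨m, h'⟩
      · exact ⟨(i, j'), k.trans (k'.trans (LIso.append (LIso.refl _) (LIso.map_mul π h')))⟩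
      · refine absurd hl (not_anis_hyp (m := m.map (π * ·) ++ cl e i) (k.trans (k'.trans
          ((LIso.append (LIso.refl _) (LIso.map_mul π h')).trans
            ((LIso.perm List.perm_append_comm).trans ?_)))))
        have := LIso.hyp G.two π G.π0 (m.map (π * ·) ++ cl e i)
        simpa using this

theorem Gd.scale_hs (G : Gd F e π s t) (n : ℕ) : LIso ((hs F n).map (π * ·)) (hs F n) := by
  induction n with
  | zero => exact LIso.refl _
  | succ n ih =>
    have := LIso.hyp G.two π G.π0 ((hs F n).map (π * ·))
    refine LIso.trans ?_ (this.trans (LIso.cons _ (LIso.cons _ ih)))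
    simp [hs]
    exact LIso.refl _

theorem Gd.table2 (G : Gd F e π s t) (i j : Fin 4 × Fin 4) : ∃ (n : ℕ) (m : List F),
    LIso (cl2 e π i ++ (cl2 e π j).map (fun x => -x)) (hs F n ++ m) ∧
      m.length = dd i.1 j.1 + dd i.2 j.2 ∧ (diagL m).Anisotropic := by
  obtain ⟨n, m, h, hm, hs1⟩ := G.table i.1 j.1
  obtain ⟨n', m', h', hm', hs1'⟩ := G.table i.2 j.2
  refine ⟨n + n', m ++ m'.map (π * ·), ?_, by simp [hm, hm'], G.anis hs1 hs1'⟩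
  have k := LIso.append h (LIso.map_mul π h')
  have e1 : (cl2 e π i ++ (cl2 e π j).map (fun x => -x)).Perm
      ((cl e i.1 ++ (cl e j.1).map (fun x => -x)) ++
        (cl e i.2 ++ (cl e j.2).map (fun x => -x)).map (π * ·)) := by
    have : (cl2 e π j).map (fun x => -x) =
      (cl e j.1).map (fun x => -x) ++ ((cl e j.2).map (fun x => -x)).map (π * ·) := by
      simp [cl2, Function.comp_def]
    rw [this, List.map_append]
    unfold cl2
    simp only [List.append_assoc]
    refine List.Perm.append_left _ ?_
    rw [← List.append_assoc, ← List.append_assoc]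
    exact List.Perm.append_right _ List.perm_append_comm
  refine (LIso.perm e1).trans (k.trans ?_)
  have e2 : LIso ((hs F n ++ m) ++ (hs F n' ++ m').map (π * ·))
      ((hs F n ++ m) ++ (hs F n' ++ m'.map (π * ·))) := by
    rw [List.map_append]
    exact LIso.append_left _ (LIso.append (G.scale_hs n') (LIso.refl _))
  refine e2.trans (LIso.perm ?_)
  rw [hs_add]
  simp only [List.append_assoc]
  refine List.Perm.append_left _ ?_
  rw [← List.append_assoc, ← List.append_assoc]
  exact List.Perm.append_right _ List.perm_append_comm

theorem Gd.package (G : Gd F e π s t) : ∃ J : Fin 4 × Fin 4 → AniData F,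
    (∀ i, (J i).1 = dd i.1 0 + dd i.2 0) ∧
    (∀ x : AniData F, ∃ i, QIsom x.2.1 (J i).2.1) ∧
    (∀ i j, ∃ w : AniData F, w.1 = dd i.1 j.1 + dd i.2 j.2 ∧
      WittEquiv w.2.1 ((J i).2.1.prod (-(J j).2.1))) ∧
    (∀ (w : AniData F) (i j), WittEquiv w.2.1 ((J i).2.1.prod (-(J j).2.1)) →
      w.1 = dd i.1 j.1 + dd i.2 j.2) := by
  refine ⟨fun i => ⟨(cl2 e π i).length, diagL (cl2 e π i),
    G.anis (G.subN_cl i.1) (G.subN_cl i.2)⟩, ?_, ?_, ?_, ?_⟩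
  · rintro ⟨i, j⟩
    fin_cases i <;> fin_cases j <;> rfl
  · rintro ⟨d, Q, hQ⟩
    have : Invertible (2 : F) := invertibleOfNonzero G.two
    obtain ⟨w, ⟨φ⟩⟩ := QuadraticForm.equivalent_weightedSumSquares Q
    have h1 : QIsom Q (QuadraticMap.weightedSumSquares F w) := ⟨φ.toLinearEquiv, φ.map_app⟩
    have h2 : QIsom (QuadraticMap.weightedSumSquares F w) (diagL (List.ofFn w)) := by
      refine ⟨LinearEquiv.funCongrLeft F F (finCongr (by simp)), fun x => ?_⟩
      rw [diagL_apply, QuadraticMap.weightedSumSquares_apply]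
      refine Fintype.sum_equiv (finCongr (by simp)) _ _ fun i => ?_
      simp [LinearMap.funLeft, pow_two]
      left; rfl
    have h3 := h1.trans h2
    obtain ⟨i, hi⟩ := G.classify _ (h3.anisotropic hQ)
    exact ⟨i, h3.trans hi⟩
  · intro i j
    obtain ⟨n, m, h, hm, ha⟩ := G.table2 i j
    refine ⟨⟨m.length, diagL m, ha⟩, hm, n, 0, ?_⟩
    refine (hs_append_iso G.two n m).symm.trans (QIsom.trans h.symm ?_)
    refine QIsom.trans ?_ ((((QIsom.refl _).prod (diagL_neg _).symm)).prod (QIsom.refl _))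
    exact (hs_append_iso G.two 0 _).trans ((diagL_append _ _).prod (QIsom.refl _))
  · rintro ⟨d, w, hw⟩ i j ⟨a, b, h⟩
    obtain ⟨n, m, h', hm, ha⟩ := G.table2 i j
    rw [← hm]
    refine witt_dim w (diagL m) hw ha a (b + n) (h.trans ?_)
    refine QIsom.trans ((((QIsom.refl _).prod (diagL_neg _)).trans
      (diagL_append _ _).symm).prod (QIsom.refl _)) ?_
    refine (hs_append_iso G.two b _).symm.trans ?_
    refine QIsom.trans (LIso.append_left (hs F b) h') ?_
    rw [← List.append_assoc, ← hs_add]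
    exact hs_append_iso G.two _ _

theorem QIsom.degree {d d' : ℕ} {Q : QuadraticForm F (Fin d → F)} {Q' : QuadraticForm F (Fin d' → F)}
    (h : QIsom Q Q') : d = d' := by
  obtain ⟨φ, -⟩ := h
  simpa using φ.finrank_eq

theorem aniRel_exact {x y : AniData F} (h : Quot.mk (AniRel F) x = Quot.mk (AniRel F) y) :
    QIsom x.2.1 y.2.1 := by
  have he : Equivalence (AniRel F) :=
    ⟨fun x => QIsom.refl _, fun h => QIsom.symm h, fun h h' => QIsom.trans h h'⟩
  exact (he.eqvGen_iff).1 (Quot.eqvGen_exact h)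

theorem WittEquiv.congr_right {M M' M'' : Type} [AddCommGroup M] [Module F M]
    [AddCommGroup M'] [Module F M'] [AddCommGroup M''] [Module F M'']
    {Q : QuadraticForm F M} {Q' : QuadraticForm F M'} {Q'' : QuadraticForm F M''}
    (h : WittEquiv Q Q') (h' : QIsom Q' Q'') : WittEquiv Q Q'' := by
  obtain ⟨a, b, h⟩ := h
  exact ⟨a, b, h.trans (h'.prod (QIsom.refl _))⟩

end Table

theorem dd_zero : ∀ i j : Fin 4 × Fin 4, dd i.1 j.1 + dd i.2 j.2 = 0 → i = j := by decide
theorem dd_self : ∀ i : Fin 4 × Fin 4, dd i.1 i.1 + dd i.2 i.2 = 0 := by decide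

theorem bij_of_package {F : Type} [Field F] (J : Fin 4 × Fin 4 → AniData F)
    (h1 : ∀ x : AniData F, ∃ i, QIsom x.2.1 (J i).2.1)
    (h2 : ∀ i j, ∃ w : AniData F, w.1 = dd i.1 j.1 + dd i.2 j.2 ∧
      WittEquiv w.2.1 ((J i).2.1.prod (-(J j).2.1)))
    (h3 : ∀ (w : AniData F) (i j), WittEquiv w.2.1 ((J i).2.1.prod (-(J j).2.1)) →
      w.1 = dd i.1 j.1 + dd i.2 j.2) :
    Function.Bijective (fun i => Quot.mk (AniRel F) (J i)) := by
  constructor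
  · intro i j hij
    have h := aniRel_exact hij
    obtain ⟨w, hw, hw'⟩ := h2 i i
    rw [dd_self] at hw
    have := h3 w i j (hw'.congr_right ((QIsom.refl _).prod h.neg))
    exact dd_zero i j (by omega)
  · intro q
    induction q using Quot.ind with
    | mk x =>
      obtain ⟨i, hi⟩ := h1 x
      exact ⟨i, Quot.sound (QIsom.symm hi)⟩

/-- There is a degree-preserving bijection `ι` between isometry classes of anisotropic forms
over `K` and over `K'`, compatible with anisotropic kernels of differences in the Witt
group. -/
theorem statement_11 (p p' : ℕ) [Fact p.Prime] [Fact p'.Prime] (hp : p ≠ 2) (hp' : p' ≠ 2)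
    (K K' : Type) [Field K] [Field K'] [Algebra ℚ_[p] K] [FiniteDimensional ℚ_[p] K]
    [Algebra ℚ_[p'] K'] [FiniteDimensional ℚ_[p'] K'] :
    ∃ ι : Quot (AniRel K) ≃ Quot (AniRel K'),
      (∀ (x : AniData K) (y : AniData K'), ι (Quot.mk _ x) = Quot.mk _ y → y.1 = x.1) ∧
      (∀ u v w : AniData K, WittEquiv w.2.1 (u.2.1.prod (-(v.2.1))) →
        ∀ (u' v' : AniData K'), ι (Quot.mk _ u) = Quot.mk _ u' →
          ι (Quot.mk _ v) = Quot.mk _ v' →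
          ∃ w' : AniData K', w'.1 = w.1 ∧ WittEquiv w'.2.1 (u'.2.1.prod (-(v'.2.1)))) := by
  classical
  obtain ⟨e, π, s, t, g1, g2, g3, g4⟩ := good_of_padic p hp K
  obtain ⟨e', π', s', t', g1', g2', g3', g4'⟩ := good_of_padic p' hp' K'
  obtain ⟨J, j1, j2, j3, j4⟩ := (Gd.mk g1 g2 g3 g4 : Gd K e π s t).package
  obtain ⟨J', j1', j2', j3', j4'⟩ := (Gd.mk g1' g2' g3' g4' : Gd K' e' π' s' t').package
  let E := Equiv.ofBijective _ (bij_of_package J j2 j3 j4)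
  let E' := Equiv.ofBijective _ (bij_of_package J' j2' j3' j4')
  have key : ∀ (x : AniData K) (y : AniData K'),
      (E.symm.trans E') (Quot.mk _ x) = Quot.mk _ y →
      ∃ i, QIsom x.2.1 (J i).2.1 ∧ QIsom (J' i).2.1 y.2.1 := by
    intro x y h
    obtain ⟨i, hi⟩ := E.surjective (Quot.mk _ x)
    refine ⟨i, (aniRel_exact (show Quot.mk _ (J i) = _ from hi)).symm, ?_⟩
    rw [← hi] at h
    simp only [Equiv.trans_apply, Equiv.symm_apply_apply] at h
    exact aniRel_exact (show Quot.mk _ (J' i) = _ from h)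
  refine ⟨E.symm.trans E', ?_, ?_⟩
  · intro x y h
    obtain ⟨i, h1, h2⟩ := key x y h
    rw [h1.degree, ← h2.degree, j1, j1']
  · intro u v w hw u' v' hu hv
    obtain ⟨i, hi, hi'⟩ := key u u' hu
    obtain ⟨j, hj, hj'⟩ := key v v' hv
    have hd := j4 w i j (hw.congr_right (hi.prod hj.neg))
    obtain ⟨w', hw', hw''⟩ := j3' i j
    exact ⟨w', by rw [hw', hd], hw''.congr_right (hi'.prod hj'.neg)⟩
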